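/- Let P be a standard parabolic submonoid of M satisfying Assumption 1 and let g be a P-ribbon. Then g can be written as a product g = v_{s₁,P₁} v_{s₂,P₂} ⋯ v_{sₙ,Pₙ} where P₁ = P, each Pᵢ is a standard parabolic submonoid, sᵢ is an atom not in Pᵢ, and P_{i+1} = Pᵢ^{v_{sᵢ,Pᵢ}} (so each Pᵢ is conjugate to P). -/

import Mathlib

/-!
Common setting: Garside monoids, standard parabolic submonoids, heads,
ribbons, following Digne–Michel, "Ribbons in Garside monoids".
-/

namespace GarsidePaper

variable {M : Type*}

/-- `a` left-divides `b` : `b = a * c` for some `c`. -/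
def LDvd [Monoid M] (a b : M) : Prop := ∃ c, b = a * c

/-- `a` right-divides `b` : `b = c * a` for some `c`. -/
def RDvd [Monoid M] (a b : M) : Prop := ∃ c, b = c * a

/-- `a` is a factor of `b` : `a` left-divides a right-divisor of `b`. -/
def IsFactor [Monoid M] (a b : M) : Prop := ∃ c, LDvd a c ∧ RDvd c b

/-- A Garside structure on a (left- and right-) cancellative monoid `M`:
left/right gcds and lcms, Noetherianity, and a Garside element `Δ`. -/
structure GarsideStruct (M : Type*) [CancelMonoid M] where
  /-- left-gcd : gcd for the left-divisibility order -/
  lgcd : M → M → M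
  lgcd_dvd_left : ∀ a b, LDvd (lgcd a b) a
  lgcd_dvd_right : ∀ a b, LDvd (lgcd a b) b
  lgcd_greatest : ∀ a b d, LDvd d a → LDvd d b → LDvd d (lgcd a b)
  /-- right-lcm : lcm for the left-divisibility order -/
  rlcm : M → M → M
  ldvd_rlcm_left : ∀ a b, LDvd a (rlcm a b)
  ldvd_rlcm_right : ∀ a b, LDvd b (rlcm a b)
  rlcm_least : ∀ a b m, LDvd a m → LDvd b m → LDvd (rlcm a b) m
  /-- right-gcd : gcd for the right-divisibility order -/
  rgcd : M → M → M
  rgcd_dvd_left : ∀ a b, RDvd (rgcd a b) a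
  rgcd_dvd_right : ∀ a b, RDvd (rgcd a b) b
  rgcd_greatest : ∀ a b d, RDvd d a → RDvd d b → RDvd d (rgcd a b)
  /-- left-lcm : lcm for the right-divisibility order -/
  llcm : M → M → M
  rdvd_llcm_left : ∀ a b, RDvd a (llcm a b)
  rdvd_llcm_right : ∀ a b, RDvd b (llcm a b)
  llcm_least : ∀ a b m, RDvd a m → RDvd b m → RDvd (llcm a b) m
  /-- Noetherian: no infinite sequence where each term is a proper factor
  of the previous one. -/
  noetherian : WellFounded (fun a b : M => IsFactor a b ∧ a ≠ b)
  /-- the Garside element -/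
  Δ : M
  /-- the left- and right-divisors of `Δ` coincide -/
  delta_balanced : ∀ a : M, LDvd a Δ ↔ RDvd a Δ
  /-- the divisors of `Δ` generate `M` -/
  delta_generates : Submonoid.closure {a : M | LDvd a Δ} = ⊤

variable [CancelMonoid M]

/-- An atom: an element with no proper nontrivial divisor (factor). -/
def IsAtom' (a : M) : Prop := a ≠ 1 ∧ ∀ b : M, IsFactor b a → b = 1 ∨ b = a

/-- A standard parabolic submonoid: a submonoid closed under factors in which
every element of `M` has a maximal left-divisor (the left `P`-head) and a
maximal right-divisor (the right `P`-head) lying in `P`. -/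
structure IsStdParabolic (P : Submonoid M) : Prop where
  factor_closed : ∀ a b : M, b ∈ P → IsFactor a b → a ∈ P
  exists_left_head : ∀ g : M, ∃ h, h ∈ P ∧ LDvd h g ∧
    ∀ h', h' ∈ P → LDvd h' g → LDvd h' h
  exists_right_head : ∀ g : M, ∃ h, h ∈ P ∧ RDvd h g ∧
    ∀ h', h' ∈ P → RDvd h' g → RDvd h' h

/-- `h` is the left `P`-head `H_P g` of `g` : the maximal left-divisor of `g`
lying in `P`. -/
def IsLeftHead (P : Set M) (g h : M) : Prop :=
  h ∈ P ∧ LDvd h g ∧ ∀ h', h' ∈ P → LDvd h' g → LDvd h' h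

/-- `h` is the right `P`-head of `g` : the maximal right-divisor of `g`
lying in `P`. -/
def IsRightHead (P : Set M) (g h : M) : Prop :=
  h ∈ P ∧ RDvd h g ∧ ∀ h', h' ∈ P → RDvd h' g → RDvd h' h

/-- `g` is `P`-reduced : `H_P g = 1`, i.e. the only left-divisor of `g`
lying in `P` is `1`. -/
def PReduced (P : Set M) (g : M) : Prop := ∀ h ∈ P, LDvd h g → h = 1

/-- `P ^ g` is defined: `p ^ g` is defined (`g ≼ p * g`) for every `p ∈ P`. -/
def ConjSetDef (P : Set M) (g : M) : Prop := ∀ p ∈ P, LDvd g (p * g)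

/-- The set `P ^ g = { p ^ g : p ∈ P }`, where `p ^ g` is the unique `c`
with `p * g = g * c`. -/
def conjSet (P : Set M) (g : M) : Set M := {c : M | ∃ p ∈ P, p * g = g * c}

/-- A `P`-ribbon: a `P`-reduced element `g` such that `P ^ g` is defined. -/
def IsRibbon (P : Set M) (g : M) : Prop := PReduced P g ∧ ConjSetDef P g

/-- `P` is the smallest standard parabolic submonoid containing `S₁`. -/
def IsSmallestParabolicContaining (S₁ : Set M) (P : Submonoid M) : Prop :=
  IsStdParabolic P ∧ S₁ ⊆ (P : Set M) ∧
    ∀ Q : Submonoid M, IsStdParabolic Q → S₁ ⊆ (Q : Set M) → P ≤ Q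

/-- Assumption 1: for any set `S₁` of atoms, the right-lcm of `S₁` is the
Garside element `Δ_{P₁} = H_{P₁}(Δ)` of the smallest standard parabolic
submonoid `P₁` containing `S₁`. -/
def Assumption1 (G : GarsideStruct M) : Prop :=
  ∀ S₁ : Set M, (∀ s ∈ S₁, IsAtom' s) →
    ∀ P₁ : Submonoid M, IsSmallestParabolicContaining S₁ P₁ →
      ∀ d : M, IsLeftHead (P₁ : Set M) G.Δ d →
        (∀ s ∈ S₁, LDvd s d) ∧ ∀ m : M, (∀ s ∈ S₁, LDvd s m) → LDvd d m

/-- Assumption 2: some (positive) power of `Δ` is central. -/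
def Assumption2 (G : GarsideStruct M) : Prop :=
  ∃ n : ℕ, 0 < n ∧ ∀ x : M, G.Δ ^ n * x = x * G.Δ ^ n

/-- `v = v_{s,P}` : the element defined by `Δ_{P_s} = Δ_P * v`, where `P_s`
is the smallest standard parabolic submonoid containing `P` and `s`. -/
def IsVsp (G : GarsideStruct M) (P : Submonoid M) (s v : M) : Prop :=
  ∃ Ps : Submonoid M, IsSmallestParabolicContaining ((P : Set M) ∪ {s}) Ps ∧
    ∃ dP dPs : M, IsLeftHead (P : Set M) G.Δ dP ∧
      IsLeftHead (Ps : Set M) G.Δ dPs ∧ dPs = dP * v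

section Divisibility

variable {a b c : M}

theorem LDvd.trans (h : LDvd a b) (h' : LDvd b c) : LDvd a c := by
  obtain ⟨x, rfl⟩ := h
  obtain ⟨y, rfl⟩ := h'
  exact ⟨x * y, mul_assoc _ _ _⟩

theorem RDvd.trans (h : RDvd a b) (h' : RDvd b c) : RDvd a c := by
  obtain ⟨x, rfl⟩ := h
  obtain ⟨y, rfl⟩ := h'
  exact ⟨y * x, (mul_assoc _ _ _).symm⟩

theorem LDvd.isFactor (h : LDvd a b) : IsFactor a b := ⟨b, h, 1, (one_mul b).symm⟩

theorem RDvd.isFactor (h : RDvd a b) : IsFactor a b := ⟨a, ⟨1, (mul_one a).symm⟩, h⟩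

namespace GarsideStruct

theorem eq_of_isFactor_of_isFactor (G : GarsideStruct M) (h : IsFactor a b) (h' : IsFactor b a) :
    a = b := by
  by_contra hne
  exact G.noetherian.asymmetric _ _ ⟨h, hne⟩ ⟨h', Ne.symm hne⟩

theorem eq_one_of_ldvd_one (G : GarsideStruct M) (h : LDvd a 1) : a = 1 :=
  G.eq_of_isFactor_of_isFactor h.isFactor (LDvd.isFactor ⟨a, (one_mul a).symm⟩)

theorem exists_atom_ldvd (G : GarsideStruct M) (ha : a ≠ 1) : ∃ s, IsAtom' s ∧ LDvd s a := by
  obtain ⟨s, ⟨hs1, hsa⟩, hmin⟩ := G.noetherian.has_min {x : M | x ≠ 1 ∧ LDvd x a}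
    ⟨a, ha, 1, (mul_one a).symm⟩
  have key : ∀ x, x ≠ 1 → LDvd x s → x = s := fun x hx hxs => by
    by_contra hne
    exact hmin x ⟨hx, hxs.trans hsa⟩ ⟨hxs.isFactor, hne⟩
  refine ⟨s, ⟨hs1, fun b hb => ?_⟩, hsa⟩
  obtain ⟨c, ⟨y, rfl⟩, x, hx⟩ := hb
  by_cases hx1 : x = 1
  · by_cases hb1 : b = 1
    · exact Or.inl hb1
    · exact Or.inr (key b hb1 ⟨y, by rw [hx, hx1, one_mul]⟩)
  · have hxs := key x hx1 ⟨_, hx⟩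
    rw [hxs] at hx
    exact Or.inl (G.eq_one_of_ldvd_one ⟨y, (mul_eq_left.mp hx.symm).symm⟩)

theorem le_of_forall_atom_mem (G : GarsideStruct M) {P Q : Submonoid M}
    (hP : ∀ a b : M, b ∈ P → IsFactor a b → a ∈ P)
    (hQ : ∀ s ∈ P, IsAtom' s → s ∈ Q) : P ≤ Q := by
  intro p
  induction p using G.noetherian.induction with
  | _ p ih =>
    intro hp
    by_cases hp1 : p = 1
    · exact hp1 ▸ Q.one_mem
    obtain ⟨s, hs, t, rfl⟩ := G.exists_atom_ldvd hp1
    have hsP : s ∈ P := hP s _ hp (LDvd.isFactor ⟨t, rfl⟩)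
    have htf : IsFactor t (s * t) := RDvd.isFactor ⟨s, rfl⟩
    exact Q.mul_mem (hQ s hsP hs)
      (ih t ⟨htf, fun h => hs.1 (mul_eq_right.mp h.symm)⟩ (hP t _ hp htf))

end GarsideStruct

end Divisibility

theorem isStdParabolic_sInf (G : GarsideStruct M) {𝒬 : Set (Submonoid M)}
    (h𝒬 : ∀ Q ∈ 𝒬, IsStdParabolic Q) : IsStdParabolic (sInf 𝒬) where
  factor_closed a b hb hab := Submonoid.mem_sInf.mpr fun Q hQ =>
    (h𝒬 Q hQ).factor_closed a b (Submonoid.mem_sInf.mp hb Q hQ) hab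
  exists_left_head g := by
    obtain ⟨h, ⟨hg, hmax⟩, hmin⟩ := G.noetherian.has_min
      {x : M | LDvd x g ∧ ∀ y ∈ sInf 𝒬, LDvd y g → LDvd y x}
      ⟨g, ⟨1, (mul_one g).symm⟩, fun _ _ h => h⟩
    refine ⟨h, Submonoid.mem_sInf.mpr fun Q hQ => ?_, hg, hmax⟩
    obtain ⟨k, hkQ, hkh, hk⟩ := (h𝒬 Q hQ).exists_left_head h
    by_contra hh
    exact hmin k ⟨hkh.trans hg, fun y hy hyg =>
      hk y (Submonoid.mem_sInf.mp hy Q hQ) (hmax y hy hyg)⟩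
      ⟨hkh.isFactor, fun e => hh (e ▸ hkQ)⟩
  exists_right_head g := by
    obtain ⟨h, ⟨hg, hmax⟩, hmin⟩ := G.noetherian.has_min
      {x : M | RDvd x g ∧ ∀ y ∈ sInf 𝒬, RDvd y g → RDvd y x}
      ⟨g, ⟨1, (one_mul g).symm⟩, fun _ _ h => h⟩
    refine ⟨h, Submonoid.mem_sInf.mpr fun Q hQ => ?_, hg, hmax⟩
    obtain ⟨k, hkQ, hkh, hk⟩ := (h𝒬 Q hQ).exists_right_head h
    by_contra hh
    exact hmin k ⟨hkh.trans hg, fun y hy hyg =>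
      hk y (Submonoid.mem_sInf.mp hy Q hQ) (hmax y hy hyg)⟩
      ⟨hkh.isFactor, fun e => hh (e ▸ hkQ)⟩

theorem exists_isSmallestParabolicContaining (G : GarsideStruct M) (S₁ : Set M) :
    ∃ P : Submonoid M, IsSmallestParabolicContaining S₁ P :=
  ⟨sInf {Q | IsStdParabolic Q ∧ S₁ ⊆ (Q : Set M)},
    isStdParabolic_sInf G fun _ hQ => hQ.1,
    fun _ hs => Submonoid.mem_sInf.mpr fun _ hQ => hQ.2 hs,
    fun _ hQ hS => sInf_le ⟨hQ, hS⟩⟩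

/-- The submonoid with carrier `P ^ g`. -/
def conjSubmonoid (P : Submonoid M) (g : M) : Submonoid M where
  carrier := conjSet (P : Set M) g
  one_mem' := ⟨1, P.one_mem, by rw [one_mul, mul_one]⟩
  mul_mem' := by
    rintro a b ⟨p, hp, hpa⟩ ⟨q, hq, hqb⟩
    exact ⟨p * q, P.mul_mem hp hq, by rw [mul_assoc, hqb, ← mul_assoc, hpa, mul_assoc]⟩

theorem mem_conjSubmonoid {P : Submonoid M} {g c : M} :
    c ∈ conjSubmonoid P g ↔ ∃ p ∈ P, p * g = g * c := Iff.rfl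

section Conjugation

variable {d a b c a' b' c' : M}

theorem mul_conj (ha : a' * d = d * a) (hb : b' * d = d * b) :
    (a' * b') * d = d * (a * b) := by
  rw [mul_assoc, hb, ← mul_assoc, ha, mul_assoc]

theorem eq_iff_eq_of_conj (ha : a' * d = d * a) (hb : b' * d = d * b) : a' = b' ↔ a = b := by
  rw [← mul_left_inj d, ha, hb, mul_right_inj]

variable {R : Submonoid M}

theorem ldvd_iff_of_conj (hR : IsStdParabolic R)
    (h₁ : ∀ p ∈ R, ∃ c ∈ R, p * d = d * c) (h₂ : ∀ c ∈ R, ∃ p ∈ R, p * d = d * c)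
    (hbR : b ∈ R) (hbR' : b' ∈ R) (ha : a' * d = d * a) (hb : b' * d = d * b) :
    LDvd a' b' ↔ LDvd a b := by
  constructor
  · rintro ⟨x', hx'⟩
    obtain ⟨x, -, hx⟩ := h₁ x' (hR.factor_closed _ _ hbR' (RDvd.isFactor ⟨a', hx'⟩))
    exact ⟨x, (eq_iff_eq_of_conj hb (mul_conj ha hx)).mp hx'⟩
  · rintro ⟨x, hx⟩
    obtain ⟨x', -, hx'⟩ := h₂ x (hR.factor_closed _ _ hbR (RDvd.isFactor ⟨a, hx⟩))
    exact ⟨x', (eq_iff_eq_of_conj hb (mul_conj ha hx')).mpr hx⟩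

theorem rdvd_iff_of_conj (hR : IsStdParabolic R)
    (h₁ : ∀ p ∈ R, ∃ c ∈ R, p * d = d * c) (h₂ : ∀ c ∈ R, ∃ p ∈ R, p * d = d * c)
    (hbR : b ∈ R) (hbR' : b' ∈ R) (ha : a' * d = d * a) (hb : b' * d = d * b) :
    RDvd a' b' ↔ RDvd a b := by
  constructor
  · rintro ⟨x', hx'⟩
    obtain ⟨x, -, hx⟩ := h₁ x' (hR.factor_closed _ _ hbR' (LDvd.isFactor ⟨a', hx'⟩))
    exact ⟨x, (eq_iff_eq_of_conj hb (mul_conj hx ha)).mp hx'⟩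
  · rintro ⟨x, hx⟩
    obtain ⟨x', -, hx'⟩ := h₂ x (hR.factor_closed _ _ hbR (LDvd.isFactor ⟨a, hx⟩))
    exact ⟨x', (eq_iff_eq_of_conj hb (mul_conj hx' ha)).mpr hx⟩

/-- If conjugation by `d` is an automorphism of the standard parabolic submonoid `R`, it maps
standard parabolic submonoids contained in `R` to standard parabolic submonoids. -/
theorem isStdParabolic_conjSubmonoid {P : Submonoid M} (hP : IsStdParabolic P)
    (hR : IsStdParabolic R) (hPR : P ≤ R)
    (h₁ : ∀ p ∈ R, ∃ c ∈ R, p * d = d * c) (h₂ : ∀ c ∈ R, ∃ p ∈ R, p * d = d * c) :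
    IsStdParabolic (conjSubmonoid P d) := by
  have mem_R : ∀ q p : M, p ∈ R → p * d = d * q → q ∈ R := fun q p hp h => by
    obtain ⟨c, hc, hpc⟩ := h₁ p hp
    rwa [mul_left_cancel (h.symm.trans hpc)]
  refine ⟨?_, fun g => ?_, fun g => ?_⟩
  · rintro a q ⟨p, hp, hpq⟩ ⟨c, hac, hcq⟩
    have hqR := mem_R q p (hPR hp) hpq
    have hcR := hR.factor_closed _ _ hqR hcq.isFactor
    obtain ⟨c', hcR', hc'⟩ := h₂ c hcR
    obtain ⟨a', -, ha'⟩ := h₂ a (hR.factor_closed _ _ hcR hac.isFactor)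
    exact ⟨a', hP.factor_closed a' p hp
      ⟨c', (ldvd_iff_of_conj hR h₁ h₂ hcR hcR' ha' hc').mpr hac,
        (rdvd_iff_of_conj hR h₁ h₂ hqR (hPR hp) hc' hpq).mpr hcq⟩, ha'⟩
  · obtain ⟨h, hhR, hhg, hh⟩ := hR.exists_left_head g
    obtain ⟨h', hhR', hh'⟩ := h₂ h hhR
    obtain ⟨k', hkP, hkh, hk⟩ := hP.exists_left_head h'
    obtain ⟨k, hkR, hk'⟩ := h₁ k' (hPR hkP)
    refine ⟨k, ⟨k', hkP, hk'⟩,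
      ((ldvd_iff_of_conj hR h₁ h₂ hhR hhR' hk' hh').mp hkh).trans hhg, ?_⟩
    rintro q ⟨p, hp, hpq⟩ hqg
    have hqh := hh q (mem_R q p (hPR hp) hpq) hqg
    exact (ldvd_iff_of_conj hR h₁ h₂ hkR (hPR hkP) hpq hk').mp
      (hk p hp ((ldvd_iff_of_conj hR h₁ h₂ hhR hhR' hpq hh').mpr hqh))
  · obtain ⟨h, hhR, hhg, hh⟩ := hR.exists_right_head g
    obtain ⟨h', hhR', hh'⟩ := h₂ h hhR
    obtain ⟨k', hkP, hkh, hk⟩ := hP.exists_right_head h'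
    obtain ⟨k, hkR, hk'⟩ := h₁ k' (hPR hkP)
    refine ⟨k, ⟨k', hkP, hk'⟩,
      ((rdvd_iff_of_conj hR h₁ h₂ hhR hhR' hk' hh').mp hkh).trans hhg, ?_⟩
    rintro q ⟨p, hp, hpq⟩ hqg
    have hqh := hh q (mem_R q p (hPR hp) hpq) hqg
    exact (rdvd_iff_of_conj hR h₁ h₂ hkR (hPR hkP) hpq hk').mp
      (hk p hp ((rdvd_iff_of_conj hR h₁ h₂ hhR hhR' hpq hh').mpr hqh))

end Conjugation

section Delta

variable {G : GarsideStruct M} {P R : Submonoid M} {d e v s : M}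

theorem isSmallestParabolicContaining_atoms (G : GarsideStruct M) (hP : IsStdParabolic P) :
    IsSmallestParabolicContaining {s | s ∈ P ∧ IsAtom' s} P :=
  ⟨hP, fun _ hs => hs.1, fun _ _ hQ =>
    G.le_of_forall_atom_mem hP.factor_closed fun _ hs ha => hQ ⟨hs, ha⟩⟩

theorem atom_ldvd_delta (hA : Assumption1 G) (hP : IsStdParabolic P)
    (hd : IsLeftHead (P : Set M) G.Δ d) (hsP : s ∈ P) (hs : IsAtom' s) : LDvd s d :=
  (hA _ (fun _ h => h.2) P (isSmallestParabolicContaining_atoms G hP) d hd).1 s ⟨hsP, hs⟩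

/-- The left and right `P`-heads of `Δ` coincide. -/
theorem isRightHead_delta (hP : IsStdParabolic P) (hd : IsLeftHead (P : Set M) G.Δ d) :
    IsRightHead (P : Set M) G.Δ d := by
  obtain ⟨e, heP, heΔ, he⟩ := hP.exists_right_head G.Δ
  have hed : LDvd e d := hd.2.2 e heP ((G.delta_balanced e).mpr heΔ)
  have hde : RDvd d e := he d hd.1 ((G.delta_balanced d).mp hd.2.1)
  rw [G.eq_of_isFactor_of_isFactor hde.isFactor hed.isFactor]
  exact ⟨heP, heΔ, he⟩

theorem ldvd_delta_iff_rdvd_delta (hP : IsStdParabolic P) (hd : IsLeftHead (P : Set M) G.Δ d)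
    {a : M} : LDvd a d ↔ RDvd a d := by
  have hd' := isRightHead_delta hP hd
  constructor
  · intro h
    exact hd'.2.2 a (hP.factor_closed a d hd.1 h.isFactor)
      ((G.delta_balanced a).mp (h.trans hd.2.1))
  · intro h
    exact hd.2.2 a (hP.factor_closed a d hd.1 h.isFactor)
      ((G.delta_balanced a).mpr (h.trans hd'.2.1))

theorem exists_conj_delta (hA : Assumption1 G) (hP : IsStdParabolic P)
    (hd : IsLeftHead (P : Set M) G.Δ d) : ∀ p ∈ P, ∃ c ∈ P, p * d = d * c := by
  let Q : Submonoid M :=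
    { carrier := {p | ∃ c ∈ P, p * d = d * c}
      one_mem' := ⟨1, P.one_mem, by rw [one_mul, mul_one]⟩
      mul_mem' := by
        rintro a b ⟨a', ha', ha⟩ ⟨b', hb', hb⟩
        exact ⟨a' * b', P.mul_mem ha' hb', mul_conj ha hb⟩ }
  refine G.le_of_forall_atom_mem (Q := Q) hP.factor_closed fun s hsP hs => ?_
  obtain ⟨b, hb⟩ := atom_ldvd_delta hA hP hd hsP hs
  obtain ⟨c, hc⟩ := (ldvd_delta_iff_rdvd_delta hP hd).mpr ⟨s, hb⟩
  refine ⟨c, hP.factor_closed c d hd.1 (RDvd.isFactor ⟨b, hc⟩), ?_⟩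
  calc s * d = s * (b * c) := by rw [← hc]
    _ = d * c := by rw [← mul_assoc, ← hb]

theorem exists_conj_delta_eq (hA : Assumption1 G) (hP : IsStdParabolic P)
    (hd : IsLeftHead (P : Set M) G.Δ d) : ∀ c ∈ P, ∃ p ∈ P, p * d = d * c := by
  refine G.le_of_forall_atom_mem (Q := conjSubmonoid P d) hP.factor_closed fun s hsP hs => ?_
  obtain ⟨b, hb⟩ := (ldvd_delta_iff_rdvd_delta hP hd).mp (atom_ldvd_delta hA hP hd hsP hs)
  obtain ⟨a, ha⟩ := (ldvd_delta_iff_rdvd_delta hP hd).mp ⟨s, hb⟩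
  refine ⟨a, hP.factor_closed a d hd.1 (LDvd.isFactor ⟨b, ha⟩), ?_⟩
  calc a * d = a * (b * s) := by rw [← hb]
    _ = d * s := by rw [← mul_assoc, ← ha]

theorem conjSubmonoid_delta_mul (hA : Assumption1 G) (hP : IsStdParabolic P)
    (hd : IsLeftHead (P : Set M) G.Δ d) : conjSubmonoid P (d * v) = conjSubmonoid P v := by
  ext q
  constructor
  · rintro ⟨p, hp, hpq⟩
    obtain ⟨c, hc, hpc⟩ := exists_conj_delta hA hP hd p hp
    refine ⟨c, hc, mul_left_cancel (a := d) ?_⟩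
    rw [← mul_assoc, ← hpc, mul_assoc, hpq, mul_assoc]
  · rintro ⟨p, hp, hpq⟩
    obtain ⟨c, hc, hcp⟩ := exists_conj_delta_eq hA hP hd p hp
    exact ⟨c, hc, by rw [← mul_assoc, hcp, mul_assoc, hpq, mul_assoc]⟩

theorem isStdParabolic_conjSubmonoid_of_delta (hA : Assumption1 G) (hP : IsStdParabolic P)
    (hR : IsStdParabolic R) (hPR : P ≤ R) (hd : IsLeftHead (P : Set M) G.Δ d)
    (he : IsLeftHead (R : Set M) G.Δ (d * v)) : IsStdParabolic (conjSubmonoid P v) := by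
  rw [← conjSubmonoid_delta_mul hA hP hd]
  exact isStdParabolic_conjSubmonoid hP hR hPR (exists_conj_delta hA hR he)
    (exists_conj_delta_eq hA hR he)

/-- If `v` left-divides a `P`-ribbon `v * g`, then `g` is a `P ^ v`-ribbon. -/
theorem IsRibbon.of_mul {g : M} (hg : IsRibbon (P : Set M) (v * g)) :
    IsRibbon (conjSubmonoid P v : Set M) g := by
  constructor
  · rintro q ⟨p, hp, hpq⟩ ⟨x, rfl⟩
    have hp1 : p = 1 := hg.1 p hp ⟨v * x, by rw [← mul_assoc v, ← hpq, mul_assoc]⟩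
    rw [hp1, one_mul] at hpq
    exact mul_eq_left.mp hpq.symm
  · rintro q ⟨p, hp, hpq⟩
    obtain ⟨x, hx⟩ := hg.2 p hp
    refine ⟨x, mul_left_cancel (a := v) ?_⟩
    rw [← mul_assoc, ← hpq, mul_assoc, hx, mul_assoc]

/-- A nontrivial `P`-ribbon is left-divisible by some `v_{s,P}`, with `P ^ v_{s,P}` standard
parabolic. -/
theorem IsRibbon.exists_isVsp (hA : Assumption1 G) (hP : IsStdParabolic P) {g : M}
    (hg : IsRibbon (P : Set M) g) (hg1 : g ≠ 1) :
    ∃ s v, IsAtom' s ∧ s ∉ P ∧ IsVsp G P s v ∧ IsStdParabolic (conjSubmonoid P v) ∧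
      v ≠ 1 ∧ LDvd v g := by
  obtain ⟨s, hs, hsg⟩ := G.exists_atom_ldvd hg1
  have hsP : s ∉ P := fun h => hs.1 (hg.1 s h hsg)
  obtain ⟨R, hR, hsub, hRmin⟩ := exists_isSmallestParabolicContaining G ((P : Set M) ∪ {s})
  have hPR : P ≤ R := fun x hx => hsub (Or.inl hx)
  have hsR : s ∈ R := hsub (Or.inr rfl)
  obtain ⟨d, hd⟩ := hP.exists_left_head G.Δ
  obtain ⟨e, he⟩ := hR.exists_left_head G.Δ
  obtain ⟨v, rfl⟩ : LDvd d e := he.2.2 d (hPR hd.1) hd.2.1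
  have hRatoms : IsSmallestParabolicContaining ({x | x ∈ P ∧ IsAtom' x} ∪ {s}) R := by
    refine ⟨hR, Set.union_subset (fun x hx => hPR hx.1) (Set.singleton_subset_iff.mpr hsR),
      fun Q hQ hSQ => hRmin Q hQ (Set.union_subset ?_ fun x hx => hSQ (Or.inr hx))⟩
    exact G.le_of_forall_atom_mem hP.factor_closed fun x hx hxa => hSQ (Or.inl ⟨hx, hxa⟩)
  have hlcm := hA _ (by
    rintro x (hx | rfl)
    exacts [hx.2, hs]) R hRatoms _ he
  refine ⟨s, v, hs, hsP, ⟨R, ⟨hR, hsub, hRmin⟩, d, _, hd, he, rfl⟩,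
    isStdParabolic_conjSubmonoid_of_delta hA hP hR hPR hd he, ?_, ?_⟩
  · rintro rfl
    refine hsP (hP.factor_closed s d hd.1 (LDvd.isFactor ?_))
    simpa using hlcm.1 s (Or.inr rfl)
  · obtain ⟨x, hx⟩ : LDvd (d * v) (d * g) := by
      refine hlcm.2 (d * g) ?_
      rintro y (hy | rfl)
      · exact (atom_ldvd_delta hA hP hd hy.1 hy.2).trans ⟨g, rfl⟩
      · exact hsg.trans (hg.2 d hd.1)
    exact ⟨x, mul_left_cancel (hx.trans (mul_assoc _ _ _))⟩

end Delta

/-- a `P`-ribbon `g` is a product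
`g = v_{s₁,P₁} ⋯ v_{sₙ,Pₙ}` with `P₁ = P`, each `Pᵢ` standard parabolic,
`sᵢ` an atom not in `Pᵢ`, and `P_{i+1} = Pᵢ ^ (v_{sᵢ,Pᵢ})`. -/
theorem statement4 (G : GarsideStruct M) (hA : Assumption1 G)
    (P : Submonoid M) (hP : IsStdParabolic P)
    (g : M) (hg : IsRibbon (P : Set M) g) :
    ∃ (n : ℕ) (Pseq : ℕ → Submonoid M) (s v : ℕ → M),
      Pseq 0 = P ∧
      (∀ i, i ≤ n → IsStdParabolic (Pseq i)) ∧
      (∀ i, i < n → IsAtom' (s i) ∧ s i ∉ Pseq i ∧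
        IsVsp G (Pseq i) (s i) (v i) ∧
        ((Pseq (i + 1) : Set M) = conjSet (Pseq i : Set M) (v i))) ∧
      g = (List.ofFn fun j : Fin n => v j).prod := by
  induction g using G.noetherian.induction generalizing P with
  | _ g ih =>
    by_cases hg1 : g = 1
    · exact ⟨0, fun _ => P, fun _ => 1, fun _ => 1, rfl, fun _ _ => hP,
        fun i hi => absurd hi (Nat.not_lt_zero i), by simpa using hg1⟩
    obtain ⟨s, v, hs, hsP, hv, hPv, hv1, g', rfl⟩ := hg.exists_isVsp hA hP hg1
    obtain ⟨n, Pseq, s', v', h0, hpar, hstep, hprod⟩ :=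
      ih g' ⟨RDvd.isFactor ⟨v, rfl⟩, fun h => hv1 (mul_eq_right.mp h.symm)⟩ _ hPv hg.of_mul
    refine ⟨n + 1, fun i => Nat.casesOn i P Pseq, fun i => Nat.casesOn i s s',
      fun i => Nat.casesOn i v v', rfl, ?_, ?_, ?_⟩
    · rintro (_ | i) hi
      exacts [hP, hpar i (Nat.le_of_succ_le_succ hi)]
    · rintro (_ | i) hi
      · exact ⟨hs, hsP, hv, congrArg _ h0⟩
      · exact hstep i (Nat.lt_of_succ_lt_succ hi)
    · rw [List.ofFn_succ, List.prod_cons, hprod]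
      rfl

end GarsidePaper
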